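/- arXiv:2108.06646 — 2 statements merged into one kernel-verified Lean document; each statement's English description precedes it below -/
import Mathlib

section
/- There exists a delicate overlap-free binary word of length n if and only if n ≥ 7. -/
/-- An overlap is a word of the form xYxYx where x is a letter and Y is a
possibly empty word. -/
def IsOverlap {α : Type*} (w : List α) : Prop :=
  ∃ (x : α) (Y : List α), w = [x] ++ Y ++ [x] ++ Y ++ [x]

/-- A word contains an overlap if some factor (contiguous subword) of it is an overlap. -/
def HasOverlap {α : Type*} (w : List α) : Prop :=
  ∃ u, u <:+: w ∧ IsOverlap u

/-- A word is overlap-free if none of its factors is an overlap. -/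
def OverlapFree {α : Type*} (w : List α) : Prop := ¬ HasOverlap w

/-- A delicate overlap-free binary word: a nonempty overlap-free word over {0,1}
such that changing any one of its letters to the other letter creates an overlap. -/
def DelicateOverlapFree (w : List (Fin 2)) : Prop :=
  w ≠ [] ∧ OverlapFree w ∧
    ∀ (i : ℕ) (h : i < w.length) (a : Fin 2), a ≠ w.get ⟨i, h⟩ → HasOverlap (w.set i a)

theorem hasOverlap_iff {α : Type*} (l : List α) :
    HasOverlap l ↔ ∃ i < l.length, ∃ m < l.length, 0 < m ∧ i + 2 * m < l.length ∧
      ∀ k < m + 1, l[i + k]? = l[i + k + m]? := by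
  constructor
  · rintro ⟨u, ⟨a, b, rfl⟩, x, Y, rfl⟩
    refine ⟨a.length, by simp, Y.length + 1, by simp; omega, by omega, by simp; omega, ?_⟩
    intro k hk
    have hl : a ++ ([x] ++ Y ++ [x] ++ Y ++ [x]) ++ b = a ++ ((x :: Y) ++ ((x :: Y) ++ x :: b)) := by
      simp
    have hr : (a ++ ((x :: Y) ++ ((x :: Y) ++ x :: b)))[a.length + k + (Y.length + 1)]? =
        ((x :: Y) ++ x :: b)[k]? := by
      rw [List.getElem?_append_right (by omega),
        List.getElem?_append_right (by rw [List.length_cons]; omega), List.length_cons]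
      congr 1
      omega
    rw [hl, hr, List.getElem?_append_right (by omega), Nat.add_sub_cancel_left]
    rcases Nat.lt_succ_iff_lt_or_eq.1 hk with h | rfl
    · rw [List.getElem?_append_left (by simpa using h), List.getElem?_append_left (by simpa using h)]
    · simp
  · rintro ⟨i, hi, m, -, hm, him, h⟩
    obtain ⟨m, rfl⟩ : ∃ q, m = q + 1 := ⟨m - 1, by omega⟩
    refine ⟨(l.drop i).take (2 * m + 3), ?_, l[i], (l.drop (i + 1)).take m, ?_⟩
    · exact (List.take_prefix _ _).isInfix.trans (List.drop_suffix _ _).isInfix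
    · have hY : ((l.drop (i + 1)).take m).length = m := by simp; omega
      have hx : l[i]? = some l[i] := List.getElem?_eq_getElem hi
      have h0 := h 0 (by omega)
      have h1 := h (m + 1) (by omega)
      apply List.ext_getElem?
      intro k
      simp only [List.append_assoc, List.cons_append, List.nil_append]
      rcases Nat.lt_or_ge k (m + 1) with hk | hk
      · rw [← List.cons_append, List.getElem?_append_left (by simp; omega)]
        rcases k with _ | k
        · simp [hx]
        · simp [show k < m by omega, show k < 2 * m + 2 by omega]
          congr 1; omega
      · rw [← List.cons_append, List.getElem?_append_right (by simp; omega)]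
        obtain ⟨j, rfl⟩ : ∃ j, k = m + 1 + j := ⟨k - (m + 1), by omega⟩
        have hj : m + 1 + j - (l[i] :: (l.drop (i + 1)).take m).length = j := by
          rw [List.length_cons, hY]; omega
        rw [hj]
        rcases Nat.lt_or_ge j (m + 1) with hk | hk
        · rw [← List.cons_append, List.getElem?_append_left (by simp; omega)]
          have := h j (by omega)
          rcases j with _ | j
          · simp_all [show m + 1 < 2 * m + 3 by omega]
          · simp [show j < m by omega,
              show m + 1 + (j + 1) < 2 * m + 3 by omega]
            rw [show i + 1 + j = i + (j + 1) by omega, this]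
            congr 1; omega
        · rw [← List.cons_append, List.getElem?_append_right (by simp; omega)]
          obtain ⟨j, rfl⟩ : ∃ q, j = m + 1 + q := ⟨j - (m + 1), by omega⟩
          rw [List.length_cons, hY]
          rcases j with _ | j
          · have e : i + (m + 1 + (m + 1 + 0)) = i + (m + 1) + (m + 1) := by omega
            have e' : m + 1 + (m + 1 + 0) < 2 * m + 3 := by omega
            simp only [List.getElem?_take, e', if_true, List.getElem?_drop, e, ← h1]
            simpa [hx] using h0.symm
          · rw [List.getElem?_eq_none (by simp; omega), List.getElem?_eq_none (by simp)]

instance decidablePredHasOverlap {α : Type*} [DecidableEq α] :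
    DecidablePred (HasOverlap : List α → Prop) :=
  fun l => decidable_of_iff _ (hasOverlap_iff l).symm

instance decidablePredDelicateOverlapFree : DecidablePred DelicateOverlapFree :=
  fun w => inferInstanceAs (Decidable (w ≠ [] ∧ ¬ HasOverlap w ∧
    ∀ (i : ℕ) (h : i < w.length) (a : Fin 2), a ≠ w.get ⟨i, h⟩ → HasOverlap (w.set i a)))

theorem DelicateOverlapFree.seven_le_length {w : List (Fin 2)} (hw : DelicateOverlapFree w) :
    7 ≤ w.length := by
  have key : ∀ n < 7, ∀ f : Fin n → Fin 2, ¬ DelicateOverlapFree (List.ofFn f) := by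
    decide +kernel
  by_contra! h
  exact key _ h w.get (by rwa [List.ofFn_get])

/-- The Thue-Morse sequence. -/
def thueMorse (n : ℕ) : Fin 2 := Fin.ofNat 2 (Nat.digits 2 n).sum

theorem thueMorse_two_mul (n : ℕ) : thueMorse (2 * n) = thueMorse n := by
  rcases Nat.eq_zero_or_pos n with rfl | hn
  · rfl
  · simp [thueMorse, Nat.digits_base_mul one_lt_two hn]

theorem thueMorse_two_mul_add_one (n : ℕ) : thueMorse (2 * n + 1) = thueMorse n + 1 := by
  have := Nat.digits_add_two_add_one 0 (2 * n)
  simp only [zero_add] at this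
  rw [thueMorse, this, show (2 * n + 1) % 2 = 1 by omega, show (2 * n + 1) / 2 = n by omega,
    List.sum_cons, thueMorse, add_comm]
  ext
  simp [Fin.val_add]

/-- The values `f s, …, f (e - 1)` contain an overlap. -/
def OverlapOn (f : ℕ → Fin 2) (s e : ℕ) : Prop :=
  ∃ i < e, s ≤ i ∧ ∃ m < e, 0 < m ∧ i + 2 * m < e ∧ ∀ k < m + 1, f (i + k) = f (i + k + m)

/-- Changing any of the values `f s, …, f (e - 1)` creates an overlap among them. -/
def Fragile (f : ℕ → Fin 2) (s e : ℕ) : Prop :=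
  ∀ p < e, s ≤ p → ∀ a, a ≠ f p → OverlapOn (Function.update f p a) s e

instance decidableFragile (f : ℕ → Fin 2) (s e : ℕ) : Decidable (Fragile f s e) :=
  inferInstanceAs (Decidable (∀ p < e, s ≤ p → ∀ a, a ≠ f p → ∃ i < e, s ≤ i ∧ ∃ m < e, 0 < m ∧
    i + 2 * m < e ∧ ∀ k < m + 1,
      Function.update f p a (i + k) = Function.update f p a (i + k + m)))

theorem OverlapOn.mono {f : ℕ → Fin 2} {s e s' e' : ℕ} (h : OverlapOn f s e) (hs : s' ≤ s)
    (he : e ≤ e') : OverlapOn f s' e' := by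
  obtain ⟨i, hi, hsi, m, hm, h0, hlt, hk⟩ := h
  exact ⟨i, by omega, by omega, m, by omega, h0, by omega, hk⟩

theorem Fragile.translate {f g : ℕ → Fin 2} {s e d : ℕ} {c : Fin 2} (hf : Fragile f s e)
    (hg : ∀ x < e, g (d + x) = f x + c) : Fragile g (d + s) (d + e) := by
  intro p hp hsp a ha
  obtain ⟨p, rfl⟩ : ∃ q, p = d + q := ⟨p - d, by omega⟩
  have hu : ∀ x < e, Function.update g (d + p) a (d + x) =
      Function.update f p (a - c) x + c := by
    intro x hx
    rcases eq_or_ne x p with rfl | hxp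
    · simp
    · simp [hxp, hg x hx]
  obtain ⟨i, hi, hsi, m, hm, h0, hlt, hk⟩ := hf p (by omega) (by omega) (a - c) (by
    rintro h
    apply ha
    rw [hg p (by omega), ← h, sub_add_cancel])
  refine ⟨d + i, by omega, by omega, m, by omega, h0, by omega, fun k hkm => ?_⟩
  rw [add_assoc, add_assoc, hu _ (by omega), hk k hkm, hu _ (by omega), add_assoc]

theorem not_overlap_thueMorse (m : ℕ) (hm : 0 < m) :
    ∀ i, ¬ ∀ k < m + 1, thueMorse (i + k) = thueMorse (i + k + m) := by
  induction m using Nat.strong_induction_on with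
  | _ m ih =>
    intro i h
    rcases Nat.even_or_odd' m with ⟨q, rfl | rfl⟩
    · refine ih q (by omega) (by omega) (i / 2) fun k hk => ?_
      have hk2 := h (2 * k) (by omega)
      rcases Nat.even_or_odd' i with ⟨j, rfl | rfl⟩
      · rw [show 2 * j + 2 * k + 2 * q = 2 * (j + k + q) by ring,
          show 2 * j + 2 * k = 2 * (j + k) by ring, thueMorse_two_mul, thueMorse_two_mul] at hk2
        rwa [show 2 * j / 2 = j by omega]
      · rw [show 2 * j + 1 + 2 * k + 2 * q = 2 * (j + k + q) + 1 by ring,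
          show 2 * j + 1 + 2 * k = 2 * (j + k) + 1 by ring, thueMorse_two_mul_add_one,
          thueMorse_two_mul_add_one] at hk2
        rw [show (2 * j + 1) / 2 = j by omega]
        exact add_right_cancel hk2
    · have step : ∀ k < 2 * q + 1, thueMorse (i + k + 1) = thueMorse (i + k) + 1 := by
        intro k hk
        rcases Nat.even_or_odd' (i + k) with ⟨j, hj | hj⟩
        · rw [hj, thueMorse_two_mul, thueMorse_two_mul_add_one]
        · have h0 := h k (by omega)
          have h1 := h (k + 1) (by omega)
          rw [← add_assoc] at h1
          rw [h0, h1, hj, show 2 * j + 1 + (2 * q + 1) = 2 * (j + q + 1) by ring,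
            show 2 * j + 1 + 1 + (2 * q + 1) = 2 * (j + q + 1) + 1 by ring,
            thueMorse_two_mul, thueMorse_two_mul_add_one]
      have two : ∀ x : Fin 2, x + 1 + 1 = x := by decide
      have alt : ∀ k ≤ q, thueMorse (i + 2 * k) = thueMorse i := by
        intro k
        induction k with
        | zero => simp
        | succ k ihk =>
          intro hk
          rw [← ihk (by omega), show i + 2 * (k + 1) = i + (2 * k + 1) + 1 by ring,
            step _ (by omega), ← add_assoc, step _ (by omega), two]
      have h0 := h 0 (by omega)
      rw [add_zero, ← add_assoc, step _ (by omega), alt q le_rfl] at h0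
      generalize thueMorse i = x at h0
      revert x
      decide

theorem thueMorse_two_pow_mul_add (r q x : ℕ) (hx : x < 2 ^ r) :
    thueMorse (2 ^ r * q + x) = thueMorse x + thueMorse q := by
  induction r generalizing x with
  | zero => obtain rfl : x = 0 := by omega
            simp [thueMorse]
  | succ r ih =>
    rw [pow_succ] at hx
    rcases Nat.even_or_odd' x with ⟨j, rfl | rfl⟩
    · rw [show 2 ^ (r + 1) * q + 2 * j = 2 * (2 ^ r * q + j) by ring, thueMorse_two_mul,
        thueMorse_two_mul, ih j (by omega)]
    · rw [show 2 ^ (r + 1) * q + (2 * j + 1) = 2 * (2 ^ r * q + j) + 1 by ring,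
        thueMorse_two_mul_add_one, thueMorse_two_mul_add_one, ih j (by omega),
        add_right_comm]

theorem Fragile.thueMorse_translate {s e : ℕ} (r q : ℕ) (h : Fragile thueMorse s e)
    (he : e ≤ 2 ^ r) : Fragile thueMorse (2 ^ r * q + s) (2 ^ r * q + e) :=
  h.translate fun x hx => thueMorse_two_pow_mul_add r q x (hx.trans_le he)

/-- Blocks of length 8 aligned at multiples of 8 are fragile, so only the ends of a window of the
Thue-Morse sequence need attention. -/
theorem fragile_thueMorse_of_ends {s e l l' : ℕ} (hl : 7 ≤ l) (hl' : 7 ≤ l') (hle : s + l ≤ e)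
    (hle' : s + l' ≤ e) (hs : Fragile thueMorse s (s + l)) (he : Fragile thueMorse (e - l') e) :
    Fragile thueMorse s e := by
  intro p hp hsp a ha
  rcases Nat.lt_or_ge p (s + l) with h | h
  · exact (hs p h hsp a ha).mono le_rfl hle
  rcases Nat.lt_or_ge p (e - l') with h' | h'
  · have h8 : Fragile thueMorse 0 8 := by decide +kernel
    have hb := h8.thueMorse_translate 3 (p / 8) (by norm_num)
    exact (hb p (by omega) (by omega) a ha).mono (by omega) (by omega)
  · exact (he p hp h' a ha).mono (by omega) le_rfl

theorem exists_fragile_thueMorse {n : ℕ} (hn : 7 ≤ n) : ∃ s, Fragile thueMorse s (s + n) := by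
  let starts : List (ℕ × ℕ) := [(0, 7), (1, 7), (12, 7), (13, 7), (24, 8), (25, 7)]
  let ends : List (ℕ × ℕ) := [(16, 8), (18, 8), (20, 7), (22, 9), (24, 8), (26, 9)]
  have hstarts : ∀ x ∈ starts, 7 ≤ x.2 ∧ Fragile thueMorse x.1 (x.1 + x.2) := by decide +kernel
  have hends : ∀ y ∈ ends, 7 ≤ y.2 ∧ y.2 ≤ y.1 ∧ y.1 ≤ 32 ∧
      Fragile thueMorse (y.1 - y.2) y.1 := by decide +kernel
  have hlengths : ∀ r < 32, ∃ x ∈ starts, ∃ y ∈ ends, ∃ j < 3,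
      7 + r + x.1 = 32 * j + y.1 ∧ x.2 ≤ 7 + r ∧ y.2 ≤ 7 + r := by decide +kernel
  obtain ⟨x, hx, y, hy, j, -, h, hxr, hyr⟩ := hlengths ((n - 7) % 32) (Nat.mod_lt _ (by norm_num))
  obtain ⟨hx7, hx⟩ := hstarts x hx
  obtain ⟨hy7, hyy, hy32, hy⟩ := hends y hy
  have hy' := hy.thueMorse_translate 5 (j + (n - 7) / 32) hy32
  refine ⟨x.1, fragile_thueMorse_of_ends hx7 hy7 (by omega) (by omega) hx ?_⟩
  convert hy' using 1 <;> omega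

theorem hasOverlap_map_range_iff (f : ℕ → Fin 2) (s n : ℕ) :
    HasOverlap ((List.range n).map fun k => f (s + k)) ↔ OverlapOn f s (s + n) := by
  rw [hasOverlap_iff]
  simp only [List.length_map, List.length_range]
  constructor
  · rintro ⟨i, hi, m, hm, h0, hlt, h⟩
    refine ⟨s + i, by omega, by omega, m, by omega, h0, by omega, fun k hk => ?_⟩
    have := h k hk
    rw [List.getElem?_map, List.getElem?_map, List.getElem?_range (by omega),
      List.getElem?_range (by omega)] at this
    simpa [add_assoc] using this
  · rintro ⟨i, hi, hsi, m, hm, h0, hlt, h⟩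
    obtain ⟨i, rfl⟩ : ∃ j, i = s + j := ⟨i - s, by omega⟩
    refine ⟨i, by omega, m, by omega, h0, by omega, fun k hk => ?_⟩
    have := h k hk
    rw [List.getElem?_map, List.getElem?_map, List.getElem?_range (by omega),
      List.getElem?_range (by omega)]
    simpa [add_assoc] using this

theorem Fragile.delicateOverlapFree {f : ℕ → Fin 2} {s n : ℕ} (h : Fragile f s (s + n))
    (hn : n ≠ 0) (hf : ¬ OverlapOn f s (s + n)) :
    DelicateOverlapFree ((List.range n).map fun k => f (s + k)) := by
  refine ⟨by simpa using hn, fun ho => hf ((hasOverlap_map_range_iff f s n).1 ho), ?_⟩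
  intro i hi a ha
  have hi' : i < n := by simpa using hi
  have hset : ((List.range n).map fun k => f (s + k)).set i a =
      (List.range n).map fun k => Function.update f (s + i) a (s + k) := by
    apply List.ext_getElem (by simp)
    intro k hk hk'
    simp only [List.getElem_set, List.getElem_map, List.getElem_range, Function.update_apply,
      add_right_inj, eq_comm]
  rw [hset, hasOverlap_map_range_iff]
  exact h (s + i) (by omega) (by omega) a (by simpa using ha)

theorem delicate_overlapFree_lengths (n : ℕ) :
    (∃ w : List (Fin 2), w.length = n ∧ DelicateOverlapFree w) ↔ 7 ≤ n := by
  constructor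
  · rintro ⟨w, rfl, hw⟩
    exact hw.seven_le_length
  · intro hn
    obtain ⟨s, hs⟩ := exists_fragile_thueMorse hn
    refine ⟨_, by simp, hs.delicateOverlapFree (by omega) ?_⟩
    rintro ⟨i, -, -, m, -, hm, -, h⟩
    exact not_overlap_thueMorse m hm i h
end

section
/- There exists a delicate cubefree binary word of length n if and only if n ∈ {20, 21, 22, 29, 33, 34, 35} or n ≥ 38. -/
/-- A cube is a word of the form XXX with X nonempty. -/
def IsCube {α : Type*} (w : List α) : Prop :=
  ∃ X : List α, X ≠ [] ∧ w = X ++ X ++ X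

/-- A word contains a cube if some factor (contiguous subword) of it is a cube. -/
def HasCube {α : Type*} (w : List α) : Prop :=
  ∃ u, u <:+: w ∧ IsCube u

/-- A word is cubefree if none of its factors is a cube. -/
def CubeFree {α : Type*} (w : List α) : Prop := ¬ HasCube w

/-- A delicate cubefree binary word: a nonempty cubefree word over {0,1}
such that changing any one of its letters to the other letter creates a cube. -/
def DelicateCubeFree (w : List (Fin 2)) : Prop :=
  w ≠ [] ∧ CubeFree w ∧
    ∀ (i : ℕ) (h : i < w.length) (a : Fin 2), a ≠ w.get ⟨i, h⟩ → HasCube (w.set i a)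

/-- The factor of `f` of length `3 * p` starting at position `s` is a cube. -/
def CubeAt (f : ℕ → Bool) (s p : ℕ) : Prop :=
  ∀ j < 2 * p, f (s + j) = f (s + j + p)

/-- The first `n` letters of `f` contain a cube. -/
def CubeBelow (f : ℕ → Bool) (n : ℕ) : Prop :=
  ∃ s p, 0 < p ∧ s + 3 * p ≤ n ∧ CubeAt f s p

/-- The binary sequence `f` with its letter at position `i` changed. -/
def flipAt (f : ℕ → Bool) (i : ℕ) : ℕ → Bool :=
  fun j => f j ^^ decide (i = j)

/-- Changing any one of the first `n` letters of `f` creates a cube among them. -/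
def CriticalBelow (f : ℕ → Bool) (n : ℕ) : Prop :=
  ∀ i < n, CubeBelow (flipAt f i) n

theorem CubeAt.congr {f g : ℕ → Bool} {s t p : ℕ} (h : CubeAt f s p)
    (hfg : ∀ j < 3 * p, f (s + j) = g (t + j)) : CubeAt g t p := by
  intro j hj
  have h₁ := hfg j (by omega)
  have h₂ := hfg (j + p) (by omega)
  rw [add_assoc, ← h₁, ← h₂, ← add_assoc]
  exact h j hj

theorem CubeBelow.congr {f g : ℕ → Bool} {n : ℕ} (h : CubeBelow f n)
    (hfg : ∀ j < n, f j = g j) : CubeBelow g n := by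
  obtain ⟨s, p, hp, hs, hc⟩ := h
  exact ⟨s, p, hp, hs, hc.congr fun j hj => hfg _ (by omega)⟩

theorem CubeBelow.mono {f : ℕ → Bool} {m n : ℕ} (h : CubeBelow f m) (hmn : m ≤ n) :
    CubeBelow f n := by
  obtain ⟨s, p, hp, hs, hc⟩ := h
  exact ⟨s, p, hp, hs.trans hmn, hc⟩

theorem flipAt_congr {f g : ℕ → Bool} {n : ℕ} (hfg : ∀ j < n, f j = g j) (i : ℕ) :
    ∀ j < n, flipAt f i j = flipAt g i j := by
  intro j hj
  simp [flipAt, hfg j hj]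

theorem CriticalBelow.congr {f g : ℕ → Bool} {n : ℕ} (h : CriticalBelow f n)
    (hfg : ∀ j < n, f j = g j) : CriticalBelow g n :=
  fun i hi => (h i hi).congr (flipAt_congr hfg i)

/-- The letters of a binary word, as a sequence of bits. -/
def wordBits (w : List (Fin 2)) (i : ℕ) : Bool :=
  decide (w[i]? = some 1)

theorem wordBits_eq_iff {w : List (Fin 2)} {i j : ℕ} (hi : i < w.length) (hj : j < w.length) :
    wordBits w i = wordBits w j ↔ w[i]? = w[j]? := by
  simp only [wordBits, List.getElem?_eq_getElem hi, List.getElem?_eq_getElem hj, Option.some.injEq,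
    decide_eq_decide]
  generalize w[i] = a
  generalize w[j] = b
  revert a b
  decide

theorem hasCube_iff_cubeBelow (w : List (Fin 2)) :
    HasCube w ↔ CubeBelow (wordBits w) w.length := by
  constructor
  · rintro ⟨_, ⟨a, b, rfl⟩, X, hX, rfl⟩
    have hp : 0 < X.length := List.length_pos_iff.2 hX
    refine ⟨a.length, X.length, hp, by simp; omega, fun j hj => ?_⟩
    rw [wordBits_eq_iff (by simp; omega) (by simp; omega)]
    have key : ∀ (u v : List (Fin 2)) i, (u ++ v)[u.length + i]? = v[i]? := fun u v i => by
      rw [List.getElem?_append_right (by omega), Nat.add_sub_cancel_left]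
    simp only [List.append_assoc]
    rw [add_assoc, key, key, add_comm j, key]
    rcases lt_or_ge j X.length with h | h
    · rw [List.getElem?_append_left h, List.getElem?_append_left h]
    · obtain ⟨i, rfl⟩ := Nat.exists_eq_add_of_le h
      rw [key, key, List.getElem?_append_left (by omega), List.getElem?_append_left (by omega)]
  · rintro ⟨s, p, hp, hs, hc⟩
    refine ⟨(w.drop s).take (3 * p), ?_, (w.drop s).take p, ?_, ?_⟩
    · exact (List.take_prefix _ _).isInfix.trans (List.drop_suffix _ _).isInfix
    · exact List.length_pos_iff.1 (by simp; omega)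
    · have key : ∀ j < 2 * p, w[s + j]? = w[s + j + p]? := fun j hj =>
        (wordBits_eq_iff (by omega) (by omega)).1 (hc j hj)
      have hl : ((w.drop s).take p).length = p := by simp; omega
      apply List.ext_getElem?
      intro j
      rw [List.append_assoc]
      rcases lt_or_ge j p with h₁ | h₁
      · rw [List.getElem?_append_left (by omega), List.getElem?_take_of_lt (by omega),
          List.getElem?_take_of_lt h₁]
      rw [List.getElem?_append_right (by omega), hl]
      have k₁ := key (j - p)
      rw [show s + (j - p) + p = s + j by omega] at k₁
      rcases lt_or_ge j (2 * p) with h₂ | h₂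
      · rw [List.getElem?_append_left (by omega), List.getElem?_take_of_lt (by omega),
          List.getElem?_take_of_lt (by omega), List.getElem?_drop, List.getElem?_drop,
          k₁ (by omega)]
      rw [List.getElem?_append_right (by omega), hl]
      have k₂ := key (j - p - p)
      rw [show s + (j - p - p) + p = s + (j - p) by omega] at k₂
      rcases lt_or_ge j (3 * p) with h₃ | h₃
      · rw [List.getElem?_take_of_lt (by omega), List.getElem?_take_of_lt (by omega),
          List.getElem?_drop, List.getElem?_drop, k₂ (by omega), k₁ (by omega)]
      · rw [List.getElem?_eq_none (by simp; omega), List.getElem?_eq_none (by simp; omega)]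

theorem wordBits_set {w : List (Fin 2)} {i : ℕ} (h : i < w.length) {a : Fin 2}
    (ha : a ≠ w.get ⟨i, h⟩) :
    ∀ j < w.length, wordBits (w.set i a) j = flipAt (wordBits w) i j := by
  intro j hj
  simp only [wordBits, flipAt, List.getElem?_set]
  by_cases hij : i = j
  · subst hij
    simp only [List.get_eq_getElem] at ha
    simp only [if_true, h, List.getElem?_eq_getElem h, Option.some.injEq, decide_true,
      Bool.xor_true]
    generalize w[i] = b at ha
    revert a b
    decide
  · simp [hij]

theorem delicateCubeFree_iff (w : List (Fin 2)) :
    DelicateCubeFree w ↔ w.length ≠ 0 ∧ ¬ CubeBelow (wordBits w) w.length ∧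
      CriticalBelow (wordBits w) w.length := by
  unfold DelicateCubeFree CubeFree
  rw [hasCube_iff_cubeBelow, ne_eq, ← List.length_eq_zero_iff]
  refine and_congr_right fun _ => and_congr_right fun _ => ⟨fun H i hi => ?_, fun H i hi a ha => ?_⟩
  · have ha : 1 - w.get ⟨i, hi⟩ ≠ w.get ⟨i, hi⟩ := by
      generalize w.get ⟨i, hi⟩ = b
      revert b
      decide
    have := (hasCube_iff_cubeBelow _).1 (H i hi _ ha)
    rw [List.length_set] at this
    exact this.congr (wordBits_set hi ha)
  · rw [hasCube_iff_cubeBelow, List.length_set]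
    exact (H i hi).congr fun j hj => (wordBits_set hi ha j hj).symm

theorem exists_delicateCubeFree_iff (n : ℕ) :
    (∃ w : List (Fin 2), w.length = n ∧ DelicateCubeFree w) ↔
      n ≠ 0 ∧ ∃ f, ¬ CubeBelow f n ∧ CriticalBelow f n := by
  constructor
  · rintro ⟨w, rfl, hw⟩
    obtain ⟨h₀, h₁, h₂⟩ := (delicateCubeFree_iff w).1 hw
    exact ⟨h₀, _, h₁, h₂⟩
  · rintro ⟨h₀, f, h₁, h₂⟩
    let w : List (Fin 2) := List.ofFn fun i : Fin n => if f i then 1 else 0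
    have hl : w.length = n := List.length_ofFn
    have hf : ∀ j < n, f j = wordBits w j := by
      intro j hj
      cases h : f j <;> simp [wordBits, w, hj, h]
    refine ⟨w, hl, (delicateCubeFree_iff w).2 ⟨by omega, ?_, ?_⟩⟩
    · rw [hl]
      exact fun h => h₁ (h.congr fun j hj => (hf j hj).symm)
    · rw [hl]
      exact h₂.congr hf

/-! ### Words as natural numbers -/

theorem testBit_xor_two_pow (N i : ℕ) : (Nat.xor N (Nat.pow 2 i)).testBit = flipAt N.testBit i := by
  funext j
  refine (Nat.testBit_xor ..).trans ?_
  rw [show Nat.pow 2 i = 2 ^ i from rfl, Nat.testBit_two_pow]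
  rfl

/-- The bits of `y` at positions below `k` do not contradict a cube of period `p` starting
at position `s`. -/
def compat (k y s p : ℕ) : Bool :=
  Nat.beq (Nat.mod (Nat.shiftRight (Nat.mod (Nat.xor y (Nat.shiftRight y p))
    (Nat.pow 2 (Nat.sub k p))) s) (Nat.pow 2 (Nat.mul 2 p))) 0

theorem compat_iff (k y s p : ℕ) : compat k y s p = true ↔
    ∀ j < 2 * p, s + j + p < k → y.testBit (s + j) = y.testBit (s + j + p) := by
  have : compat k y s p = true ↔ (((y ^^^ (y >>> p)) % 2 ^ (k - p)) >>> s) % 2 ^ (2 * p) = 0 :=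
    Iff.of_eq Nat.beq_eq
  rw [this]
  constructor
  · intro h j hj hk
    have h' := congrArg (Nat.testBit · j) h
    have h₁ : s + j < k - p := by omega
    simpa [Nat.testBit_mod_two_pow, hj, h₁, add_comm p] using h'
  · intro h
    apply Nat.eq_of_testBit_eq
    intro j
    simp only [Nat.testBit_mod_two_pow, Nat.testBit_shiftRight, Nat.testBit_xor, Nat.zero_testBit]
    by_cases hj : j < 2 * p
    · by_cases hk : s + j < k - p
      · simp [h j hj (by omega), add_comm p]
      · simp [hk]
    · simp [hj]

theorem compat_iff_cubeAt {k y s p : ℕ} (h : s + 3 * p ≤ k) :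
    compat k y s p = true ↔ CubeAt y.testBit s p := by
  rw [compat_iff]
  exact forall₂_congr fun j hj => ⟨fun H => H (by omega), fun H _ => H⟩

/-- The pairs `(s, p)` for which the factor of length `3 * p` starting at `s` contains position `i`
and stays below `n`. -/
def cands (n i : ℕ) : List (ℕ × ℕ) :=
  (List.range' 1 (n / 3)).flatMap fun p =>
    ((List.range' (i + 1 - 3 * p) (3 * p)).filter fun s =>
      Nat.ble s i && Nat.ble (s + 3 * p) n).map fun s => (s, p)

theorem mem_cands {n i s p : ℕ} :
    (s, p) ∈ cands n i ↔ 0 < p ∧ s + 3 * p ≤ n ∧ s ≤ i ∧ i < s + 3 * p := by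
  simp only [cands, List.mem_flatMap, List.mem_map, List.mem_filter, List.mem_range'_1,
    Bool.and_eq_true, Prod.mk.injEq, Nat.ble_eq]
  constructor
  · rintro ⟨q, hq, t, ht, rfl, rfl⟩
    omega
  · intro h
    exact ⟨p, by omega, s, by omega, rfl, rfl⟩

theorem exists_mem_cands {f : ℕ → Bool} {n i : ℕ} (hf : ¬ CubeBelow f n)
    (h : CubeBelow (flipAt f i) n) : ∃ c ∈ cands n i, CubeAt (flipAt f i) c.1 c.2 := by
  obtain ⟨s, p, hp, hs, hc⟩ := h
  by_cases hi : s ≤ i ∧ i < s + 3 * p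
  · exact ⟨(s, p), mem_cands.2 ⟨hp, hs, hi⟩, hc⟩
  · refine absurd ⟨s, p, hp, hs, hc.congr fun j hj => ?_⟩ hf
    have : i ≠ s + j := by omega
    simp [flipAt, this]

/-! ### Exhaustive search for delicate words of a given length

The search extends a prefix letter by letter. It carries, for each position whose change has not
yet been seen to create a cube, the list of cubes that may still arise. Recursors are used
directly, so that the kernel evaluates the search quickly. -/

/-- The first `k` bits of `P` end in a cube of period at most `q`. -/
noncomputable def cubeSuffix (k P q : ℕ) : Bool :=
  Nat.rec (motive := fun _ => Bool) false (fun q ih =>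
    bif compat k P (Nat.sub k (Nat.mul 3 (Nat.succ q))) (Nat.succ q) then true else ih) q

/-- Discard the cubes in `C` which cannot arise by changing position `i`; fail if none is left. -/
noncomputable def advance (k P i : ℕ) (c : List (ℕ × List (ℕ × ℕ)) → Bool)
    (M : List (ℕ × List (ℕ × ℕ))) (C : List (ℕ × ℕ)) : Bool :=
  List.rec (motive := fun _ => Bool) true (fun x C ih =>
    bif compat k (Nat.xor P (Nat.pow 2 i)) x.1 x.2 then
      c (bif Nat.ble (Nat.add x.1 (Nat.mul 3 x.2)) k then M else (i, x :: C) :: M)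
    else ih) C

/-- Apply `advance` to all entries of a list, and continue with the result. -/
noncomputable def refineAll (k P : ℕ) (L : List (ℕ × List (ℕ × ℕ))) :
    (List (ℕ × List (ℕ × ℕ)) → Bool) → Bool :=
  List.rec (motive := fun _ => (List (ℕ × List (ℕ × ℕ)) → Bool) → Bool) (fun c => c [])
    (fun x _ ih c => ih fun M => advance k P x.1 c M x.2) L

/-- Returns `true` if the search finds no delicate word of length `n` whose prefix of length
`n + 1 - r` is given by `P`. -/
noncomputable def noDelicate (n r : ℕ) : ℕ → List (ℕ × List (ℕ × ℕ)) → Bool :=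
  Nat.rec (motive := fun _ => ℕ → List (ℕ × List (ℕ × ℕ)) → Bool) (fun _ _ => false)
    (fun r ih P L =>
      bif cubeSuffix (Nat.sub n r) P (Nat.div (Nat.sub n r) 3) then true
      else refineAll (Nat.sub n r) P L fun M =>
        bif ih P ((Nat.sub n r, cands n (Nat.sub n r)) :: M) then
          ih (Nat.lor P (Nat.pow 2 (Nat.sub n r))) ((Nat.sub n r, cands n (Nat.sub n r)) :: M)
        else false) r

/-- The bits of `P` are the first `k` letters of `f`. -/
def IsPrefixCode (f : ℕ → Bool) (k P : ℕ) : Prop :=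
  ∀ j, P.testBit j = (decide (j < k) && f j)

/-- The entry consists of a position below `k` and a list containing a cube which arises from
changing that position. -/
def Alive (f : ℕ → Bool) (k : ℕ) (x : ℕ × List (ℕ × ℕ)) : Prop :=
  x.1 < k ∧ ∃ c ∈ x.2, CubeAt (flipAt f x.1) c.1 c.2

theorem IsPrefixCode.eq {f : ℕ → Bool} {k P : ℕ} (h : IsPrefixCode f k P) {j : ℕ} (hj : j < k) :
    P.testBit j = f j := by
  simp [h j, hj]

theorem cubeBelow_of_cubeSuffix {f : ℕ → Bool} {k P q : ℕ} (hP : IsPrefixCode f k P)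
    (hq : 3 * q ≤ k) (h : cubeSuffix k P q = true) : CubeBelow f k := by
  induction q with
  | zero => exact absurd h (by simp [cubeSuffix])
  | succ q ih =>
    have h' : (bif compat k P (k - 3 * (q + 1)) (q + 1) then true else cubeSuffix k P q) = true := h
    cases hc : compat k P (k - 3 * (q + 1)) (q + 1) with
    | false =>
      rw [hc] at h'
      exact ih (by omega) h'
    | true =>
      rw [compat_iff_cubeAt (by omega)] at hc
      exact ⟨_, _, q.succ_pos, by omega, hc.congr fun j hj => hP.eq (by omega)⟩

theorem exists_of_advance {f : ℕ → Bool} {k P i : ℕ} (hP : IsPrefixCode f k P)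
    {c : List (ℕ × List (ℕ × ℕ)) → Bool} {M : List (ℕ × List (ℕ × ℕ))}
    (hM : ∀ x ∈ M, Alive f k x) {C : List (ℕ × ℕ)} (hC : Alive f k (i, C))
    (h : advance k P i c M C = true) : ∃ M', (∀ x ∈ M', Alive f k x) ∧ c M' = true := by
  induction C with
  | nil =>
    obtain ⟨-, x, hx, -⟩ := hC
    exact absurd hx List.not_mem_nil
  | cons y C ih =>
    have h' : (bif compat k (Nat.xor P (Nat.pow 2 i)) y.1 y.2 then
      c (bif Nat.ble (Nat.add y.1 (Nat.mul 3 y.2)) k then M else (i, y :: C) :: M)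
      else advance k P i c M C) = true := h
    cases hy : compat k (Nat.xor P (Nat.pow 2 i)) y.1 y.2 with
    | true =>
      rw [hy] at h'
      refine ⟨_, ?_, h'⟩
      cases Nat.ble (Nat.add y.1 (Nat.mul 3 y.2)) k with
      | true => exact hM
      | false => exact List.forall_mem_cons.2 ⟨hC, hM⟩
    | false =>
      rw [hy] at h'
      refine ih ⟨hC.1, ?_⟩ h'
      obtain ⟨-, x, hx, hcube⟩ := hC
      rcases List.mem_cons.1 hx with rfl | hx
      · rw [Bool.eq_false_iff, ne_eq, compat_iff] at hy
        refine absurd (fun j hj hk => ?_) hy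
        have hf := flipAt_congr (fun j hj => hP.eq hj) i
        rw [testBit_xor_two_pow, hf _ (by omega), hf _ hk]
        exact hcube j hj
      · exact ⟨x, hx, hcube⟩

theorem exists_of_refineAll {f : ℕ → Bool} {k P : ℕ} (hP : IsPrefixCode f k P)
    {L : List (ℕ × List (ℕ × ℕ))} (hL : ∀ x ∈ L, Alive f k x)
    {c : List (ℕ × List (ℕ × ℕ)) → Bool} (h : refineAll k P L c = true) :
    ∃ M, (∀ x ∈ M, Alive f k x) ∧ c M = true := by
  induction L generalizing c with
  | nil => exact ⟨[], hL, h⟩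
  | cons y L ih =>
    obtain ⟨hy, hL⟩ := List.forall_mem_cons.1 hL
    obtain ⟨M, hM, hc⟩ := ih hL (c := fun M => advance k P y.1 c M y.2) h
    exact exists_of_advance hP hM hy hc

theorem not_criticalBelow_of_noDelicate_of_prefix {f : ℕ → Bool} {n r P : ℕ}
    {L : List (ℕ × List (ℕ × ℕ))} (hr : r ≤ n + 1) (hP : IsPrefixCode f (n + 1 - r) P)
    (hL : ∀ x ∈ L, Alive f (n + 1 - r) x) (hf : ¬ CubeBelow f n)
    (h : noDelicate n r P L = true) : ¬ CriticalBelow f n := by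
  induction r generalizing P L with
  | zero => exact absurd h (by simp [noDelicate])
  | succ r ih =>
    intro hcrit
    rw [Nat.add_sub_add_right] at hP hL
    have h' : (bif cubeSuffix (n - r) P ((n - r) / 3) then true
      else refineAll (n - r) P L fun M =>
        bif noDelicate n r P ((n - r, cands n (n - r)) :: M) then
          noDelicate n r (P ||| 2 ^ (n - r)) ((n - r, cands n (n - r)) :: M)
        else false) = true := h
    cases hs : cubeSuffix (n - r) P ((n - r) / 3) with
    | true => exact hf ((cubeBelow_of_cubeSuffix hP (by omega) hs).mono (by omega))
    | false =>
      rw [hs] at h'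
      obtain ⟨M, hM, hc⟩ := exists_of_refineAll hP hL h'
      rw [Bool.cond_false_right, Bool.and_eq_true] at hc
      obtain rfl | hr₀ := Nat.eq_zero_or_pos r
      · exact absurd hc.1 (by simp [noDelicate])
      have e : n + 1 - r = n - r + 1 := by omega
      have hM' : ∀ x ∈ (n - r, cands n (n - r)) :: M, Alive f (n + 1 - r) x := by
        refine List.forall_mem_cons.2 ⟨⟨by simp only; omega, ?_⟩, fun x hx => ?_⟩
        · exact exists_mem_cands hf (hcrit _ (by omega))
        · exact ⟨(hM x hx).1.trans (by omega), (hM x hx).2⟩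
      cases hb : f (n - r) with
      | false =>
        refine ih (by omega) (fun j => ?_) hM' hc.1 hcrit
        rw [hP, e]
        rcases eq_or_ne j (n - r) with rfl | hj
        · simp [hb]
        · congr 2
          simp; omega
      | true =>
        refine ih (by omega) (fun j => ?_) hM' hc.2 hcrit
        rw [Nat.testBit_or, Nat.testBit_two_pow, hP, e]
        rcases eq_or_ne j (n - r) with rfl | hj
        · simp [hb]
        · rw [decide_eq_false hj.symm, Bool.or_false]
          congr 2
          simp; omega

theorem CubeBelow.complement {f : ℕ → Bool} {n : ℕ} (h : CubeBelow f n) :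
    CubeBelow (fun j => !f j) n := by
  obtain ⟨s, p, hp, hs, hc⟩ := h
  exact ⟨s, p, hp, hs, fun j hj => congrArg (!·) (hc j hj)⟩

theorem CriticalBelow.complement {f : ℕ → Bool} {n : ℕ} (h : CriticalBelow f n) :
    CriticalBelow (fun j => !f j) n :=
  fun i hi => (h i hi).complement.congr fun j _ => by simp [flipAt]

/-- By symmetry, it suffices to search for words that start with `0`. -/
theorem not_criticalBelow_of_noDelicate {f : ℕ → Bool} {n : ℕ} (hn : 0 < n)
    (hf : ¬ CubeBelow f n) (h : noDelicate n n 0 [(0, cands n 0)] = true) :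
    ¬ CriticalBelow f n := by
  wlog h0 : f 0 = false generalizing f
  · intro hcrit
    refine this (f := fun j => !f j) (fun hc => hf ?_) (by simpa using h0) hcrit.complement
    simpa using hc.complement
  intro hcrit
  refine not_criticalBelow_of_noDelicate_of_prefix (r := n) (by omega) (fun j => ?_)
    (List.forall_mem_singleton.2 ⟨by simp, exists_mem_cands hf (hcrit 0 hn)⟩) hf h hcrit
  obtain rfl | hj := Nat.eq_zero_or_pos j
  · simp [h0]
  · simp; omega

set_option maxRecDepth 100000 in
theorem noDelicate_exceptional_lengths : ∀ n ∈ [1, 2, 3, 4, 5, 6, 7, 8, 9, 10, 11, 12, 13, 14, 15,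
    16, 17, 18, 19, 23, 24, 25, 26, 27, 28, 30, 31, 32, 36, 37],
    noDelicate n n 0 [(0, cands n 0)] = true := by
  decide +kernel

/-! ### Checking explicit words -/

/-- If a bit of `smear t a B fuel` is set, then so is one of the `t` bits of `D` starting there,
provided that this holds for `B` with `a` in place of `t`. -/
def smear (t a B : ℕ) : ℕ → ℕ
  | 0 => 0
  | fuel + 1 =>
    bif Nat.ble (Nat.mul 2 a) t then
      smear t (Nat.mul 2 a) (Nat.lor B (Nat.shiftRight B a)) fuel
    else Nat.lor B (Nat.shiftRight B (Nat.sub t a))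

theorem exists_of_testBit_smear {D t a B fuel s : ℕ} (hat : a ≤ t)
    (hB : ∀ s, B.testBit s = true → ∃ j < a, D.testBit (s + j) = true)
    (h : (smear t a B fuel).testBit s = true) : ∃ j < t, D.testBit (s + j) = true := by
  induction fuel generalizing a B with
  | zero => exact absurd h (by simp [smear])
  | succ fuel ih =>
    have step : ∀ b s, (B ||| B >>> b).testBit s = true →
        ∃ j < a + b, D.testBit (s + j) = true := by
      intro b s hs
      rw [Nat.testBit_or, Nat.testBit_shiftRight, Bool.or_eq_true] at hs
      rcases hs with hs | hs
      · obtain ⟨j, hj, hD⟩ := hB _ hs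
        exact ⟨j, by omega, hD⟩
      · obtain ⟨j, hj, hD⟩ := hB _ hs
        exact ⟨b + j, by omega, by rwa [← add_assoc, add_comm s]⟩
    have h' : (bif Nat.ble (2 * a) t then smear t (2 * a) (B ||| B >>> a) fuel
      else B ||| B >>> (t - a)).testBit s = true := h
    cases hle : Nat.ble (2 * a) t with
    | true =>
      rw [hle] at h'
      refine ih (Nat.le_of_ble_eq_true hle) (fun s hs => ?_) h'
      rw [two_mul]
      exact step a s hs
    | false =>
      rw [hle] at h'
      obtain ⟨j, hj, hD⟩ := step _ _ h'
      exact ⟨j, by omega, hD⟩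

/-- The first `n` bits of `N` contain no cube of period at most `q`. -/
def cubeFreeUpTo (n N : ℕ) : ℕ → Bool
  | 0 => true
  | q + 1 =>
    bif Nat.beq (Nat.mod (smear (Nat.mul 2 (Nat.succ q)) 1
        (Nat.xor N (Nat.shiftRight N (Nat.succ q))) 10)
        (Nat.pow 2 (Nat.sub (Nat.succ n) (Nat.mul 3 (Nat.succ q)))))
      (Nat.sub (Nat.pow 2 (Nat.sub (Nat.succ n) (Nat.mul 3 (Nat.succ q)))) 1) then
      cubeFreeUpTo n N q
    else false

theorem not_cubeAt_of_cubeFreeUpTo {n N q s p : ℕ} (h : cubeFreeUpTo n N q = true) (hp : 0 < p)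
    (hpq : p ≤ q) (hs : s + 3 * p ≤ n) : ¬ CubeAt N.testBit s p := by
  induction q with
  | zero => omega
  | succ q ih =>
    have h' : (bif Nat.beq (smear (2 * (q + 1)) 1 (N ^^^ N >>> (q + 1)) 10 %
        2 ^ (n + 1 - 3 * (q + 1))) (2 ^ (n + 1 - 3 * (q + 1)) - 1) then cubeFreeUpTo n N q
        else false) = true := h
    rw [Bool.cond_false_right, Bool.and_eq_true, Nat.beq_eq] at h'
    rcases Nat.lt_or_eq_of_le hpq with hlt | rfl
    · exact ih h'.2 (by omega)
    intro hc
    have hbit := congrArg (Nat.testBit · s) h'.1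
    have hs' : s < n + 1 - 3 * (q + 1) := by omega
    simp only [Nat.testBit_mod_two_pow, Nat.testBit_two_pow_sub_one, hs', decide_true,
      Bool.true_and] at hbit
    obtain ⟨j, hj, hD⟩ := exists_of_testBit_smear (D := N ^^^ N >>> (q + 1)) (by omega)
      (fun s hs => ⟨0, by omega, hs⟩) hbit
    rw [Nat.testBit_xor, Nat.testBit_shiftRight, hc j hj, add_comm (q + 1), Bool.xor_self] at hD
    exact Bool.false_ne_true hD

theorem not_cubeBelow_of_cubeFreeUpTo {n N : ℕ} (h : cubeFreeUpTo n N (n / 3) = true) :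
    ¬ CubeBelow N.testBit n := by
  rintro ⟨s, p, hp, hs, hc⟩
  exact not_cubeAt_of_cubeFreeUpTo h hp (by omega) hs hc

/-- Changing any one of the first `n` bits of `N` creates a cube. -/
def criticalUpTo (n N : ℕ) : Bool :=
  (List.range n).all fun i =>
    (cands n i).any fun c => compat n (Nat.xor N (Nat.pow 2 i)) c.1 c.2

theorem criticalBelow_of_criticalUpTo {n N : ℕ} (h : criticalUpTo n N = true) :
    CriticalBelow N.testBit n := by
  intro i hi
  obtain ⟨⟨s, p⟩, hc, hcube⟩ := List.any_eq_true.1 (List.all_eq_true.1 h i (List.mem_range.2 hi))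
  obtain ⟨hp, hs, -⟩ := mem_cands.1 hc
  rw [compat_iff_cubeAt hs, testBit_xor_two_pow] at hcube
  exact ⟨s, p, hp, hs, hcube⟩

/-! ### A uniform morphism with delicate images -/

/-- The images of the two letters under a cubefree morphism of length `42`. -/
def block (b : Bool) : ℕ :=
  bif b then 2556804019414 else 1841242420006

/-- The image of the sequence `x` under the morphism. -/
def image (x : ℕ → Bool) (i : ℕ) : Bool :=
  (block (x (i / 42))).testBit (i % 42)

/-- The block `block b` followed by the word `N`. -/
def consBlock (b : Bool) (N : ℕ) : ℕ :=
  Nat.lor (block b) (Nat.shiftLeft N 42)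

theorem block_lt (b : Bool) : block b < 2 ^ 42 := by
  revert b
  decide

theorem testBit_consBlock_of_lt (b : Bool) (N : ℕ) {i : ℕ} (hi : i < 42) :
    (consBlock b N).testBit i = (block b).testBit i := by
  have h : (consBlock b N).testBit i = ((block b).testBit i || (N <<< 42).testBit i) :=
    Nat.testBit_or ..
  rw [h, Nat.testBit_shiftLeft]
  simp [show ¬ 42 ≤ i by omega]

theorem testBit_consBlock_add (b : Bool) (N i : ℕ) :
    (consBlock b N).testBit (42 + i) = N.testBit i := by
  have h : (consBlock b N).testBit (42 + i) =
      ((block b).testBit (42 + i) || (N <<< 42).testBit (42 + i)) := Nat.testBit_or ..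
  rw [h, Nat.testBit_shiftLeft,
    Nat.testBit_lt_two_pow ((block_lt b).trans_le (Nat.pow_le_pow_right two_pos (by omega)))]
  simp

theorem image_mul_add (x : ℕ → Bool) (q : ℕ) {j : ℕ} (hj : j < 42) :
    image x (42 * q + j) = (block (x q)).testBit j := by
  unfold image
  rw [show (42 * q + j) / 42 = q by omega, show (42 * q + j) % 42 = j by omega]

/-- If `g` starts with `block (x q)` and continues as `N`, then so does the corresponding
`consBlock`. -/
theorem testBit_consBlock_eq {g : ℕ → Bool} {x : ℕ → Bool} {N q n : ℕ}
    (hq : ∀ j < 42, g (42 * q + j) = image x (42 * q + j))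
    (hN : ∀ j < n, g (42 * (q + 1) + j) = N.testBit j) :
    ∀ j < 42 + n, g (42 * q + j) = (consBlock (x q) N).testBit j := by
  intro j hj
  rcases lt_or_ge j 42 with h | h
  · rw [testBit_consBlock_of_lt _ _ h, hq j h, image_mul_add x q h]
  · obtain ⟨i, rfl⟩ := Nat.exists_eq_add_of_le h
    rw [testBit_consBlock_add, ← hN i (by omega)]
    congr 1
    ring

theorem block_sync_check : ∀ a b e : Bool, ∀ r < 42, 0 < r →
    Nat.beq (Nat.mod (Nat.shiftRight (consBlock a (block b)) r) (Nat.pow 2 42)) (block e) =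
      false := by
  decide +kernel

/-- Blocks occur in an image only at multiples of the block length. -/
theorem mod_eq_zero_of_image_eq_block {x : ℕ → Bool} {t : ℕ} {e : Bool}
    (h : ∀ j < 42, image x (t + j) = (block e).testBit j) : t % 42 = 0 := by
  by_contra hr
  have hc := block_sync_check (x (t / 42)) (x (t / 42 + 1)) e (t % 42) (Nat.mod_lt _ (by omega))
    (by omega)
  rw [Bool.eq_false_iff, ne_eq, Nat.beq_eq] at hc
  refine hc (Nat.eq_of_testBit_eq fun j => ?_)
  change ((consBlock (x (t / 42)) (block (x (t / 42 + 1)))) >>> (t % 42) % 2 ^ 42).testBit j = _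
  rw [Nat.testBit_mod_two_pow, Nat.testBit_shiftRight]
  by_cases hj : j < 42
  · have key := testBit_consBlock_eq (g := image x) (x := x) (q := t / 42) (n := 42)
      (fun _ _ => rfl) (fun j hj => image_mul_add x _ hj) (t % 42 + j) (by omega)
    rw [← key, ← add_assoc, Nat.div_add_mod, h j hj]
    simp [hj]
  · rw [Nat.testBit_lt_two_pow ((block_lt e).trans_le (Nat.pow_le_pow_right two_pos (by omega)))]
    simp [hj]

theorem cubeFreeUpTo_four_blocks : ∀ a b c d : Bool, ¬ (a = b ∧ b = c) → ¬ (b = c ∧ c = d) →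
    cubeFreeUpTo 168 (consBlock a (consBlock b (consBlock c (block d)))) 56 = true := by
  decide +kernel

theorem not_three_eq {x : ℕ → Bool} {m q : ℕ} (hx : ¬ CubeBelow x m) (hq : q + 3 ≤ m) :
    ¬ (x q = x (q + 1) ∧ x (q + 1) = x (q + 2)) := by
  rintro ⟨h₁, h₂⟩
  refine hx ⟨q, 1, one_pos, hq, fun j hj => ?_⟩
  obtain rfl | rfl : j = 0 ∨ j = 1 := by omega
  · exact h₁
  · exact h₂

theorem block_testBit_inj {a b : Bool} (h : (block a).testBit 4 = (block b).testBit 4) :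
    a = b := by
  revert a b
  decide

theorem not_cubeBelow_image {x : ℕ → Bool} {m : ℕ} (hm : 4 ≤ m) (hx : ¬ CubeBelow x m) :
    ¬ CubeBelow (image x) (42 * m) := by
  rintro ⟨s, p, hp, hs, hc⟩
  rcases le_or_gt p 42 with hp' | hp'
  · obtain ⟨q, hqm, hqs, hsq⟩ : ∃ q, q + 4 ≤ m ∧ 42 * q ≤ s ∧ s + 3 * p ≤ 42 * q + 168 := by
      rcases le_or_gt (s / 42 + 4) m with h | h
      · exact ⟨s / 42, h, by omega, by omega⟩
      · exact ⟨m - 4, by omega, by omega, by omega⟩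
    obtain ⟨a, rfl⟩ := Nat.exists_eq_add_of_le hqs
    have key := testBit_consBlock_eq (g := image x) (x := x) (q := q) (n := 126) (fun _ _ => rfl)
      (testBit_consBlock_eq (n := 84) (fun _ _ => rfl)
        (testBit_consBlock_eq (n := 42) (fun _ _ => rfl) fun j hj => image_mul_add x _ hj))
    refine not_cubeAt_of_cubeFreeUpTo (s := a) (cubeFreeUpTo_four_blocks _ _ _ _
      (not_three_eq hx (q := q) (by omega)) (not_three_eq hx (q := q + 1) (by omega))) hp
      (by omega) (by omega) (hc.congr fun j hj => ?_)
    rw [add_assoc]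
    exact key _ (by omega)
  · have hp42 : p % 42 = 0 := by
      obtain ⟨b, hb₁, hb₂⟩ : ∃ b, s ≤ 42 * b ∧ 42 * b < s + 42 := ⟨(s + 41) / 42, by omega, by omega⟩
      have := mod_eq_zero_of_image_eq_block (x := x) (t := 42 * b + p) (e := x b) fun j hj => by
        rw [← image_mul_add x b hj]
        have := hc (42 * b + j - s) (by omega)
        rw [show s + (42 * b + j - s) = 42 * b + j by omega] at this
        rw [this, add_right_comm]
      omega
    obtain ⟨q, rfl⟩ := Nat.dvd_of_mod_eq_zero hp42
    obtain ⟨u, hu₁, hu₂⟩ : ∃ u, s ≤ 42 * u + 4 ∧ 42 * u + 4 < s + 42 :=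
      ⟨(s + 41 - 4) / 42, by omega, by omega⟩
    refine hx ⟨u, q, by omega, by omega, fun i hi => ?_⟩
    have := hc (42 * (u + i) + 4 - s) (by omega)
    rw [show s + (42 * (u + i) + 4 - s) = 42 * (u + i) + 4 by omega,
      show 42 * (u + i) + 4 + 42 * q = 42 * (u + i + q) + 4 by ring,
      image_mul_add x _ (by omega), image_mul_add x _ (by omega)] at this
    exact block_testBit_inj this

theorem exists_not_cubeBelow (m : ℕ) : ∃ x, ¬ CubeBelow x m := by
  induction m with
  | zero => exact ⟨fun _ => false, fun ⟨s, p, hp, hs, _⟩ => by omega⟩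
  | succ m ih =>
    rcases lt_or_ge m 4 with h | h
    · have hc : ¬ CubeBelow (Nat.testBit 5) 4 :=
        not_cubeBelow_of_cubeFreeUpTo (by decide +kernel)
      exact ⟨_, fun h' => hc (h'.mono (by omega))⟩
    · obtain ⟨x, hx⟩ := ih
      exact ⟨_, fun h' => not_cubeBelow_image h hx (h'.mono (by omega))⟩

/-! ### Delicate words of all large lengths -/

/-- The image of the first `m` letters of `x`, followed by the word `S`. -/
def imageThen (x : ℕ → Bool) (m S : ℕ) (i : ℕ) : Bool :=
  bif decide (i < 42 * m) then image x i else S.testBit (i - 42 * m)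

/-- A sufficient condition for the word `S` of length `l` to yield a delicate cubefree word when
appended to the image of a cubefree word. -/
def goodTail (l S : ℕ) : Bool :=
  S.testBit 0 && criticalUpTo l S &&
  ([(false, false, true), (false, true, false), (false, true, true), (true, false, false),
    (true, false, true), (true, true, false)].all fun y =>
      cubeFreeUpTo (126 + l) (consBlock y.1 (consBlock y.2.1 (consBlock y.2.2 S)))
        ((126 + l) / 3)) &&
  ([false, true].all fun c => (List.range (l - 43)).all fun o =>
    !Nat.beq (Nat.mod (Nat.shiftRight S (o + 1)) (Nat.pow 2 43)) (consBlock c 1))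

theorem imageThen_of_lt {x : ℕ → Bool} {m S i : ℕ} (hi : i < 42 * m) :
    imageThen x m S i = image x i := by
  simp [imageThen, hi]

theorem imageThen_add {x : ℕ → Bool} {m S : ℕ} (j : ℕ) :
    imageThen x m S (42 * m + j) = S.testBit j := by
  simp [imageThen]

theorem block_testBit_zero (b : Bool) : (block b).testBit 0 = false := by
  revert b
  decide

theorem not_cubeBelow_imageThen {x : ℕ → Bool} {m l S : ℕ} (hm : 4 ≤ m) (hx : ¬ CubeBelow x m)
    (hS : goodTail l S = true) : ¬ CubeBelow (imageThen x m S) (42 * m + l) := by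
  simp only [goodTail, Bool.and_eq_true] at hS
  obtain ⟨⟨⟨h0, -⟩, htail⟩, hmark⟩ := hS
  rintro ⟨s, p, hp, hs, hc⟩
  rcases le_or_gt (s + 3 * p) (42 * m) with hin | hout
  · exact not_cubeBelow_image hm hx
      ⟨s, p, hp, hin, hc.congr fun j hj => imageThen_of_lt (by omega)⟩
  obtain ⟨q, rfl⟩ : ∃ q, m = q + 3 := ⟨m - 3, by omega⟩
  rcases le_or_gt (42 * q) s with hqs | hqs
  · obtain ⟨a, rfl⟩ := Nat.exists_eq_add_of_le hqs
    have hblock : ∀ i < 3, ∀ j < 42, imageThen x (q + 3) S (42 * (q + i) + j) =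
        image x (42 * (q + i) + j) := fun i hi j hj => imageThen_of_lt (by omega)
    have key := testBit_consBlock_eq (q := q) (n := 42 + (42 + l)) (hblock 0 (by omega))
      (testBit_consBlock_eq (q := q + 1) (n := 42 + l) (hblock 1 (by omega))
        (testBit_consBlock_eq (q := q + 2) (n := l) (hblock 2 (by omega)) fun j _ => imageThen_add j))
    have hne := not_three_eq hx (q := q) (by omega)
    have hcf : cubeFreeUpTo (126 + l) (consBlock (x q) (consBlock (x (q + 1))
        (consBlock (x (q + 2)) S))) ((126 + l) / 3) = true := by
      refine List.all_eq_true.1 htail (x q, x (q + 1), x (q + 2)) ?_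
      generalize x q = a at hne
      generalize x (q + 1) = b at hne
      generalize x (q + 2) = c at hne
      revert a b c
      decide
    refine not_cubeAt_of_cubeFreeUpTo (s := a) hcf hp (by omega) (by omega)
      (hc.congr fun j hj => ?_)
    rw [add_assoc]
    exact key _ (by omega)
  have hp' : 42 < p := by omega
  have hlast : ∀ j < 42, imageThen x (q + 3) S (42 * (q + 2) + j) =
      (block (x (q + 2))).testBit j := fun j hj => by
    rw [imageThen_of_lt (by omega), image_mul_add x _ hj]
  have hfirst : imageThen x (q + 3) S (42 * (q + 2) + 42) = true := by
    rw [← h0]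
    exact imageThen_add 0
  rcases le_or_gt (s + p) (42 * (q + 2)) with hleft | hright
  · obtain ⟨t, ht⟩ : ∃ t, 42 * (q + 2) = t + p := ⟨42 * (q + 2) - p, by omega⟩
    have hshift : ∀ j < 43, imageThen x (q + 3) S (t + j) =
        imageThen x (q + 3) S (42 * (q + 2) + j) := fun j hj => by
      have := hc (t + j - s) (by omega)
      rwa [show s + (t + j - s) = t + j by omega,
        show t + j + p = 42 * (q + 2) + j by omega] at this
    have ht0 : t % 42 = 0 := mod_eq_zero_of_image_eq_block (x := x) (e := x (q + 2)) fun j hj => by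
      rw [← hlast j hj, ← hshift j (by omega), imageThen_of_lt (by omega)]
    obtain ⟨b, rfl⟩ := Nat.dvd_of_mod_eq_zero ht0
    have := hshift 42 (by omega)
    rw [hfirst, imageThen_of_lt (by omega), show 42 * b + 42 = 42 * (b + 1) + 0 by ring,
      image_mul_add x _ (by omega), block_testBit_zero] at this
    exact Bool.false_ne_true this
  · obtain ⟨o, ho⟩ : ∃ o, p = 42 + (o + 1) := ⟨p - 43, by omega⟩
    have hshift : ∀ j < 43, S.testBit (o + 1 + j) =
        imageThen x (q + 3) S (42 * (q + 2) + j) := fun j hj => by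
      have := hc (42 * (q + 2) + j - s) (by omega)
      rw [show s + (42 * (q + 2) + j - s) = 42 * (q + 2) + j by omega,
        show 42 * (q + 2) + j + p = 42 * (q + 3) + (o + 1 + j) by omega, imageThen_add] at this
      exact this.symm
    have hne := List.all_eq_true.1 (List.all_eq_true.1 hmark (x (q + 2)) (by simp)) o
      (List.mem_range.2 (by omega))
    rw [Bool.not_eq_true', Bool.eq_false_iff, ne_eq, Nat.beq_eq] at hne
    refine hne (Nat.eq_of_testBit_eq fun j => ?_)
    change ((S >>> (o + 1)) % 2 ^ 43).testBit j = _
    rw [Nat.testBit_mod_two_pow, Nat.testBit_shiftRight]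
    rcases lt_or_ge j 42 with hj | hj
    · rw [testBit_consBlock_of_lt _ _ hj, ← hlast j hj, hshift j (by omega)]
      simp [show j < 43 by omega]
    obtain ⟨i, rfl⟩ := Nat.exists_eq_add_of_le hj
    rw [testBit_consBlock_add]
    rcases Nat.eq_zero_or_pos i with rfl | hi
    · rw [hshift _ (by omega), add_zero, hfirst]
      rfl
    · rw [Nat.testBit_lt_two_pow (Nat.one_lt_two_pow hi.ne')]
      simp [show ¬ 42 + i < 43 by omega]

theorem CubeBelow.of_flipAt_shift {f g : ℕ → Bool} {a i l n : ℕ}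
    (hg : CubeBelow (flipAt g i) l) (hfg : ∀ j < l, g j = f (a + j)) (hn : a + l ≤ n) :
    CubeBelow (flipAt f (a + i)) n := by
  obtain ⟨s, p, hp, hs, hc⟩ := hg
  refine ⟨a + s, p, hp, by omega, hc.congr fun j hj => ?_⟩
  simp [flipAt, hfg (s + j) (by omega), add_assoc]

theorem criticalUpTo_block : ∀ b : Bool, criticalUpTo 42 (block b) = true := by
  decide +kernel

theorem criticalBelow_imageThen {x : ℕ → Bool} {m l S : ℕ} (hS : goodTail l S = true) :
    CriticalBelow (imageThen x m S) (42 * m + l) := by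
  simp only [goodTail, Bool.and_eq_true] at hS
  obtain ⟨⟨⟨-, hcrit⟩, -⟩, -⟩ := hS
  intro i hi
  rcases lt_or_ge i (42 * m) with h | h
  · have hb := criticalBelow_of_criticalUpTo (criticalUpTo_block (x (i / 42))) (i % 42)
      (Nat.mod_lt _ (by omega))
    rw [← Nat.div_add_mod i 42]
    refine hb.of_flipAt_shift (fun j hj => ?_) (by omega)
    rw [imageThen_of_lt (by omega), image_mul_add x _ hj]
  · obtain ⟨j, rfl⟩ := Nat.exists_eq_add_of_le h
    exact (criticalBelow_of_criticalUpTo hcrit j (by omega)).of_flipAt_shift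
      (fun j _ => (imageThen_add j).symm) le_rfl

/-- Tails of the lengths from `38` to `79`. -/
def tails : List ℕ :=
  [108236524761,
   89445288745,
   639201102633,
   1841242491689,
   1841242491689,
   1431123446569,
   10227216468777,
   5724496907049,
   58919747242793,
   55417100749609,
   45795937798953,
   327270914509609,
   183183888534313,
   1309083795376937,
   3770864023292713,
   1465469997075241,
   10472669251816233,
   30166917416930089,
   30166917416930089,
   120667648732875561,
   241335272356891433,
   241335272356891433,
   965341139259018025,
   907953779114691369,
   2794962022982929193,
   1500643323044088617,
   3001283180911840041,
   21448027254621391657,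
   42896059840159468329,
   24010260432513846057,
   247127345231830895401,
   247127345231830895401,
   192082098786295008041,
   384164196306436934441,
   2745347437741259541289,
   5490695412977063611177,
   3073314003592098269993,
   21962779935070679124777,
   12293266878142862773033,
   87851130604057186192169,
   253058441145943020194601,
   253058441145943020194601]

set_option maxRecDepth 100000 in
theorem goodTail_tails : ∀ r < 42, goodTail (38 + r) (tails.getD r 0) = true := by
  decide +kernel

theorem exists_delicate_of_le {n : ℕ} (hn : 38 ≤ n) :
    ∃ f, ¬ CubeBelow f n ∧ CriticalBelow f n := by
  obtain ⟨m, r, hr, rfl⟩ : ∃ m r, r < 42 ∧ n = 42 * m + (38 + r) :=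
    ⟨(n - 38) / 42, (n - 38) % 42, Nat.mod_lt _ (by omega), by omega⟩
  have hS := goodTail_tails r hr
  obtain ⟨x, hx⟩ := exists_not_cubeBelow (m + 4)
  have hcf := not_cubeBelow_imageThen (by omega) hx hS
  refine ⟨imageThen (fun i => x (i + 4)) m (tails.getD r 0), ?_, criticalBelow_imageThen hS⟩
  rintro ⟨s, p, hp, hs, hc⟩
  refine hcf ⟨168 + s, p, hp, by omega, hc.congr fun j _ => ?_⟩
  rcases lt_or_ge (s + j) (42 * m) with h | h
  · rw [imageThen_of_lt h, imageThen_of_lt (by omega)]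
    unfold image
    rw [show (168 + s + j) / 42 = (s + j) / 42 + 4 by omega,
      show (168 + s + j) % 42 = (s + j) % 42 by omega]
  · obtain ⟨i, hi⟩ := Nat.exists_eq_add_of_le h
    rw [hi, imageThen_add, show 168 + s + j = 42 * (m + 4) + i by omega, imageThen_add]

theorem exists_delicate_of_checks {n N : ℕ} (h₁ : cubeFreeUpTo n N (n / 3) = true)
    (h₂ : criticalUpTo n N = true) : ∃ f, ¬ CubeBelow f n ∧ CriticalBelow f n :=
  ⟨_, not_cubeBelow_of_cubeFreeUpTo h₁, criticalBelow_of_criticalUpTo h₂⟩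

theorem delicate_cubeFree_lengths (n : ℕ) :
    (∃ w : List (Fin 2), w.length = n ∧ DelicateCubeFree w) ↔
      (n = 20 ∨ n = 21 ∨ n = 22 ∨ n = 29 ∨ n = 33 ∨ n = 34 ∨ n = 35 ∨ 38 ≤ n) := by
  rw [exists_delicateCubeFree_iff]
  constructor
  · rintro ⟨hn, f, hf, hcrit⟩
    by_contra hne
    have hmem : n ∈ [1, 2, 3, 4, 5, 6, 7, 8, 9, 10, 11, 12, 13, 14, 15, 16, 17, 18, 19,
        23, 24, 25, 26, 27, 28, 30, 31, 32, 36, 37] := by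
      have : n < 38 := by omega
      interval_cases n <;> simp at hn hne ⊢
    exact not_criticalBelow_of_noDelicate (Nat.pos_of_ne_zero hn) hf
      (noDelicate_exceptional_lengths n hmem) hcrit
  · intro h
    refine ⟨by omega, ?_⟩
    rcases h with rfl | rfl | rfl | rfl | rfl | rfl | rfl | h
    · exact exists_delicate_of_checks (N := 877972) (by decide +kernel) (by decide +kernel)
    · exact exists_delicate_of_checks (N := 877972) (by decide +kernel) (by decide +kernel)
    · exact exists_delicate_of_checks (N := 2438358) (by decide +kernel) (by decide +kernel)
    · exact exists_delicate_of_checks (N := 211399462) (by decide +kernel) (by decide +kernel)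
    · exact exists_delicate_of_checks (N := 1397581204) (by decide +kernel) (by decide +kernel)
    · exact exists_delicate_of_checks (N := 9987515796) (by decide +kernel) (by decide +kernel)
    · exact exists_delicate_of_checks (N := 14384706774) (by decide +kernel) (by decide +kernel)
    · exact exists_delicate_of_le h
end
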